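/- Let (X,Y,Z) be jointly distributed random variables, each taking values in a finite set Σ with |Σ| ≥ 2, and let ε, δ ∈ (0,1]. For any integer N ≥ 6.48×10⁶ · |Σ|³·(log(|Σ|/(ε·δ)) + log(7.2×10⁵))·log(12·|Σ|²/δ)/ε, the following holds with probability at least 1−δ over N i.i.d. samples of (X,Y,Z): (1) if I(X;Y|Z) = 0 then Î(X;Y|Z) ≤ ε/400; and (2) if I(X;Y|Z) ≥ ε then Î(X;Y|Z) ≥ I(X;Y|Z)/400. -/

import Mathlib

open scoped BigOperators

noncomputable section

open Classical in
/-- Probability that `N` i.i.d. samples from the pmf `p` satisfy the event `E`. -/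
noncomputable def iidProb {α : Type*} [Fintype α] (p : α → ℝ) (N : ℕ)
    (E : (Fin N → α) → Prop) : ℝ :=
  ∑ s : Fin N → α, if E s then ∏ i, p (s i) else 0

open Classical in
/-- Empirical frequency (relative frequency) of the outcome `a` among the samples `s`. -/
noncomputable def empFreq {α : Type*} [Fintype α] {N : ℕ} (s : Fin N → α) (a : α) : ℝ :=
  ((Finset.univ.filter fun i => s i = a).card : ℝ) / N

/-- Marginal of the first coordinate of a joint pmf. -/
noncomputable def margFst {α β : Type*} [Fintype β] (p : α × β → ℝ) (x : α) : ℝ :=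
  ∑ y, p (x, y)

/-- Marginal of the second coordinate of a joint pmf. -/
noncomputable def margSnd {α β : Type*} [Fintype α] (p : α × β → ℝ) (y : β) : ℝ :=
  ∑ x, p (x, y)

/-- Mutual information `I(X;Y)` of a joint pmf on `α × β` (natural logarithm;
summands with zero probability vanish since `Real.log 0 = 0` and `x / 0 = 0`). -/
noncomputable def mutInfo {α β : Type*} [Fintype α] [Fintype β] (p : α × β → ℝ) : ℝ :=
  ∑ x, ∑ y, p (x, y) * Real.log (p (x, y) / (margFst p x * margSnd p y))

/-- Conditional mutual information `I(X;Y∣Z)` of a joint pmf on `α × β × γ`. -/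
noncomputable def condMutInfo {α β γ : Type*} [Fintype α] [Fintype β] [Fintype γ]
    (p : α × β × γ → ℝ) : ℝ :=
  ∑ x, ∑ y, ∑ z, p (x, y, z) *
    Real.log (p (x, y, z) * (∑ x', ∑ y', p (x', y', z)) /
      ((∑ y', p (x, y', z)) * (∑ x', p (x', y, z))))

/-! ### Pointwise inequalities for the relative entropy integrand -/

/-- The nonnegative integrand `a log (a / b) - a + b` of the relative entropy. -/
def klTerm (a b : ℝ) : ℝ := a * Real.log (a / b) - a + b

theorem sq_sqrt_sub_sqrt_le_klTerm {a b : ℝ} (ha : 0 ≤ a) (hb : 0 ≤ b) (hab : b = 0 → a = 0) :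
    (√a - √b) ^ 2 ≤ klTerm a b := by
  unfold klTerm
  rcases ha.eq_or_lt with rfl | ha
  · simp [Real.sq_sqrt hb]
  have hb' : 0 < b := lt_of_le_of_ne hb fun h => ha.ne' (hab h.symm)
  obtain ⟨u, hu, rfl⟩ : ∃ u, 0 < u ∧ a = u ^ 2 := ⟨√a, Real.sqrt_pos.2 ha, (Real.sq_sqrt ha.le).symm⟩
  obtain ⟨v, hv, rfl⟩ : ∃ v, 0 < v ∧ b = v ^ 2 := ⟨√b, Real.sqrt_pos.2 hb', (Real.sq_sqrt hb).symm⟩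
  rw [Real.sqrt_sq hu.le, Real.sqrt_sq hv.le, ← div_pow, Real.log_pow]
  have h := Real.one_sub_inv_le_log_of_pos (div_pos hu hv)
  rw [inv_div] at h
  have h2 := mul_le_mul_of_nonneg_left h (by positivity : 0 ≤ 2 * u ^ 2)
  have h3 : 2 * u ^ 2 * (1 - v / u) = 2 * u ^ 2 - 2 * u * v := by field_simp
  push_cast
  nlinarith

theorem klTerm_nonneg {a b : ℝ} (ha : 0 ≤ a) (hb : 0 ≤ b) (hab : b = 0 → a = 0) :
    0 ≤ klTerm a b :=
  (sq_nonneg _).trans (sq_sqrt_sub_sqrt_le_klTerm ha hb hab)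

theorem klTerm_le_of_le {a b : ℝ} (ha : 0 ≤ a) (hab : a ≤ 9 * b) :
    klTerm a b ≤ 7 * (√a - √b) ^ 2 := by
  unfold klTerm
  have hb : 0 ≤ b := by linarith
  rcases ha.eq_or_lt with rfl | ha
  · simp [Real.sq_sqrt hb]; linarith
  have hb' : 0 < b := by linarith
  obtain ⟨u, hu, rfl⟩ : ∃ u, 0 < u ∧ a = u ^ 2 := ⟨√a, Real.sqrt_pos.2 ha, (Real.sq_sqrt ha.le).symm⟩
  obtain ⟨v, hv, rfl⟩ : ∃ v, 0 < v ∧ b = v ^ 2 := ⟨√b, Real.sqrt_pos.2 hb', (Real.sq_sqrt hb).symm⟩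
  rw [Real.sqrt_sq hu.le, Real.sqrt_sq hv.le, ← div_pow, Real.log_pow]
  have h := Real.log_le_sub_one_of_pos (div_pos hu hv)
  have h2 := mul_le_mul_of_nonneg_left h (by positivity : 0 ≤ 2 * u ^ 2)
  have h3 : 2 * u ^ 2 * (u / v - 1) - u ^ 2 + v ^ 2 = (2 * (u / v) + 1) * (u - v) ^ 2 := by
    field_simp; ring
  have h4 : u / v ≤ 3 := by
    rw [div_le_iff₀ hv]
    nlinarith
  have h5 : (2 * (u / v) + 1) * (u - v) ^ 2 ≤ 7 * (u - v) ^ 2 :=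
    mul_le_mul_of_nonneg_right (by linarith) (sq_nonneg _)
  push_cast
  linarith

theorem klTerm_le_mul_log {a b : ℝ} (hab : b ≤ a) : klTerm a b ≤ a * Real.log (a / b) := by
  unfold klTerm; linarith

theorem eq_of_klTerm_eq_zero {a b : ℝ} (ha : 0 ≤ a) (hb : 0 ≤ b) (hab : b = 0 → a = 0)
    (h : klTerm a b = 0) : a = b := by
  have h1 := sq_sqrt_sub_sqrt_le_klTerm ha hb hab
  have h2 : √a - √b = 0 := by
    rw [h] at h1
    exact pow_eq_zero_iff two_ne_zero |>.1 (le_antisymm h1 (sq_nonneg _))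
  exact (Real.sqrt_inj ha hb).1 (sub_eq_zero.1 h2)

/-- A term with a large likelihood ratio is controlled by its multiplicative perturbation. -/
theorem mul_log_le_klTerm_of_approx {a b a' b' : ℝ} (ha : 0 < a) (hb : 0 < b) (hab : 9 * b < a)
    (hb' : 0 < b') (h₁ : 9025 / 10000 * a ≤ a') (h₂ : b' ≤ 1347 / 1000 * b) :
    a * Real.log (a / b) ≤ 5 * klTerm a' b' := by
  unfold klTerm
  have hr : 0 < a / b := by positivity
  have ha' : 0 < a' := by nlinarith
  have hlog9 : 2 ≤ Real.log (a / b) := by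
    rw [Real.le_log_iff_exp_le hr, le_div_iff₀ hb]
    have h1 : Real.exp 2 = Real.exp 1 * Real.exp 1 := by rw [← Real.exp_add]; norm_num
    have h2 := Real.exp_one_lt_d9
    have h3 : Real.exp 1 * Real.exp 1 ≤ 3 * 3 := by gcongr <;> linarith
    nlinarith
  have hloss : Real.log (a / b) - 1 / 2 ≤ Real.log (a' / b') := by
    have h3 : a / b ≤ 3 / 2 * (a' / b') := by
      rw [← mul_div_assoc, div_le_div_iff₀ hb hb']
      nlinarith [mul_le_mul_of_nonneg_left h₂ ha.le, mul_le_mul_of_nonneg_right h₁ hb.le]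
    have h4 := Real.log_le_log hr h3
    rw [Real.log_mul (by norm_num) (by positivity)] at h4
    have := Real.log_le_sub_one_of_pos (show (0 : ℝ) < 3 / 2 by norm_num)
    linarith
  have h5 : a' * (Real.log (a / b) - 3 / 2) ≤ a' * (Real.log (a' / b') - 1) :=
    mul_le_mul_of_nonneg_left (by linarith) ha'.le
  have h6 : 9025 / 10000 * a * (Real.log (a / b) - 3 / 2) ≤ a' * (Real.log (a / b) - 3 / 2) :=
    mul_le_mul_of_nonneg_right h₁ (by linarith)
  nlinarith

/-- Coordinatewise projections contract the Hellinger distance. -/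
theorem sq_sqrt_sum_sub_sqrt_sum_le {ι : Type*} [Fintype ι] {f g : ι → ℝ} (hf : ∀ i, 0 ≤ f i)
    (hg : ∀ i, 0 ≤ g i) :
    (√(∑ i, f i) - √(∑ i, g i)) ^ 2 ≤ ∑ i, (√(f i) - √(g i)) ^ 2 := by
  have h := Real.sum_sqrt_mul_sqrt_le Finset.univ hf hg
  have h1 : ∑ i, (√(f i) - √(g i)) ^ 2 =
      ∑ i, f i + ∑ i, g i - 2 * ∑ i, √(f i) * √(g i) := by
    rw [Finset.mul_sum, ← Finset.sum_add_distrib, ← Finset.sum_sub_distrib]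
    refine Finset.sum_congr rfl fun i _ => ?_
    rw [sub_sq, Real.sq_sqrt (hf i), Real.sq_sqrt (hg i)]
    ring
  rw [h1, sub_sq, Real.sq_sqrt (Finset.sum_nonneg fun i _ => hf i),
    Real.sq_sqrt (Finset.sum_nonneg fun i _ => hg i)]
  linarith

/-! ### Probabilities under i.i.d. sampling -/

section Sampling

variable {α : Type*} [Fintype α] {p : α → ℝ} {N : ℕ}

theorem sum_prod_eq_pow (f : α → ℝ) (N : ℕ) :
    ∑ s : Fin N → α, ∏ i, f (s i) = (∑ a, f a) ^ N := by
  rw [Fintype.sum_pow]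

theorem one_sub_le_iidProb (hp : ∀ a, 0 ≤ p a) (hsum : ∑ a, p a = 1)
    {E B : (Fin N → α) → Prop} (h : ∀ s, (∀ i, 0 < p (s i)) → ¬ B s → E s) :
    1 - iidProb p N B ≤ iidProb p N E := by
  classical
  have h1 : (1 : ℝ) = ∑ s : Fin N → α, ∏ i, p (s i) := by
    rw [sum_prod_eq_pow, hsum, one_pow]
  rw [h1, iidProb, iidProb, sub_le_iff_le_add, ← Finset.sum_add_distrib]
  refine Finset.sum_le_sum fun s _ => ?_
  have h0 : 0 ≤ ∏ i, p (s i) := Finset.prod_nonneg fun i _ => hp _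
  by_cases hB : B s
  · simp only [hB, if_true]
    split_ifs <;> linarith
  · by_cases hs : ∀ i, 0 < p (s i)
    · simp [hB, h s hs hB]
    · push Not at hs
      obtain ⟨i, hi⟩ := hs
      rw [Finset.prod_eq_zero (Finset.mem_univ i) (le_antisymm hi (hp _))]
      simp

theorem iidProb_or_le (hp : ∀ a, 0 ≤ p a) (E F : (Fin N → α) → Prop) :
    iidProb p N (fun s => E s ∨ F s) ≤ iidProb p N E + iidProb p N F := by
  rw [iidProb, iidProb, iidProb, ← Finset.sum_add_distrib]
  refine Finset.sum_le_sum fun s _ => ?_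
  have h0 : 0 ≤ ∏ i, p (s i) := Finset.prod_nonneg fun i _ => hp _
  by_cases hE : E s <;> by_cases hF : F s <;> simp [hE, hF, h0]

theorem iidProb_exists_le (hp : ∀ a, 0 ≤ p a) {ι : Type*} [Fintype ι]
    (E : ι → (Fin N → α) → Prop) :
    iidProb p N (fun s => ∃ j, E j s) ≤ ∑ j, iidProb p N (E j) := by
  classical
  simp only [iidProb]
  rw [Finset.sum_comm]
  refine Finset.sum_le_sum fun s _ => ?_
  have h0 : 0 ≤ ∏ i, p (s i) := Finset.prod_nonneg fun i _ => hp _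
  have h1 : ∀ j ∈ Finset.univ, 0 ≤ if E j s then ∏ i, p (s i) else 0 := fun j _ => by
    split_ifs <;> simp [h0]
  by_cases hE : ∃ j, E j s
  · obtain ⟨j, hj⟩ := hE
    rw [if_pos ⟨j, hj⟩]
    simpa [hj] using Finset.single_le_sum h1 (Finset.mem_univ j)
  · rw [if_neg hE]
    exact Finset.sum_nonneg h1

/-- Markov's inequality. -/
theorem iidProb_le_sum_mul (hp : ∀ a, 0 ≤ p a) {E : (Fin N → α) → Prop} {F : (Fin N → α) → ℝ}
    (hF : ∀ s, 0 ≤ F s) (h : ∀ s, E s → 1 ≤ F s) :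
    iidProb p N E ≤ ∑ s, (∏ i, p (s i)) * F s := by
  rw [iidProb]
  refine Finset.sum_le_sum fun s _ => ?_
  have h0 : 0 ≤ ∏ i, p (s i) := Finset.prod_nonneg fun i _ => hp _
  split_ifs with hE
  · exact le_mul_of_one_le_right h0 (h s hE)
  · exact mul_nonneg h0 (hF s)

theorem empFreq_nonneg (s : Fin N → α) (a : α) : 0 ≤ empFreq s a := by
  unfold empFreq; positivity

theorem sum_empFreq_mul (hN : 0 < N) (s : Fin N → α) (f : α → ℝ) :
    N * ∑ a, empFreq s a * f a = ∑ i, f (s i) := by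
  classical
  have hN' : (N : ℝ) ≠ 0 := by positivity
  have h : ∀ a, (N : ℝ) * (empFreq s a * f a) = ∑ i, if s i = a then f (s i) else 0 := fun a => by
    rw [← Finset.sum_filter, Finset.sum_congr rfl (g := fun _ => f a)
      (fun i hi => by rw [(Finset.mem_filter.1 hi).2]), Finset.sum_const, nsmul_eq_mul, empFreq]
    field_simp
  rw [Finset.mul_sum, Finset.sum_congr rfl fun a _ => h a, Finset.sum_comm]
  simp

theorem sum_empFreq (hN : 0 < N) (s : Fin N → α) : ∑ a, empFreq s a = 1 := by
  have h := sum_empFreq_mul hN s fun _ => 1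
  have hN' : (N : ℝ) ≠ 0 := by positivity
  simpa [hN'] using h

theorem empFreq_eq_zero {s : Fin N → α} (hs : ∀ i, 0 < p (s i)) {a : α}
    (ha : p a = 0) : empFreq s a = 0 := by
  have : ∀ i, s i ≠ a := fun i hi => by
    have := hs i
    rw [hi, ha] at this
    exact lt_irrefl _ this
  simp [empFreq, this]

theorem empFreq_pos (hN : 0 < N) (s : Fin N → α) (i : Fin N) : 0 < empFreq s (s i) := by
  have h : (0 : ℝ) < N := by positivity
  exact div_pos (Nat.cast_pos.2 (Finset.card_pos.2 ⟨i, by simp⟩)) h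

/-- Multiplicative Chernoff bound; the upper tail is `1 < b` and the lower tail is `b < 1`. -/
theorem iidProb_chernoff (hp : ∀ a, 0 ≤ p a) (hsum : ∑ a, p a = 1) (hN : 0 < N) (A : Finset α)
    {b : ℝ} (hb : 0 < b) :
    iidProb p N (fun s => Real.log b * (b ^ 2 * ∑ a ∈ A, p a) ≤
        Real.log b * ∑ a ∈ A, empFreq s a) ≤
      Real.exp (-((b - 1) ^ 2 * (N * ∑ a ∈ A, p a))) := by
  classical
  set P := ∑ a ∈ A, p a with hP
  have hP0 : 0 ≤ P := Finset.sum_nonneg fun a _ => hp a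
  have hN' : (0 : ℝ) < N := by positivity
  have hcount : ∀ s : Fin N → α,
      N * ∑ a ∈ A, empFreq s a = ∑ i, if s i ∈ A then (1 : ℝ) else 0 := fun s => by
    rw [← sum_empFreq_mul hN s fun a => if a ∈ A then 1 else 0]
    simp [Finset.sum_ite_mem]
  have hexp : ∀ s : Fin N → α, Real.exp (Real.log b * (N * ∑ a ∈ A, empFreq s a)) =
      ∏ i, if s i ∈ A then b else 1 := fun s => by
    rw [hcount, Finset.mul_sum, Real.exp_sum]
    refine Finset.prod_congr rfl fun i _ => ?_
    split_ifs <;> simp [Real.exp_log hb]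
  refine (iidProb_le_sum_mul hp (F := fun s => Real.exp (-(Real.log b * (N * (b ^ 2 * P)))) *
    Real.exp (Real.log b * (N * ∑ a ∈ A, empFreq s a))) (fun s => by positivity) fun s hs => ?_).trans ?_
  · rw [← Real.exp_add]
    refine Real.one_le_exp ?_
    have := mul_le_mul_of_nonneg_left hs hN'.le
    linarith
  have hmgf : ∑ a, p a * (if a ∈ A then b else 1) = 1 + P * (b - 1) := by
    have : ∀ a, p a * (if a ∈ A then b else 1) = p a + (if a ∈ A then p a else 0) * (b - 1) :=
      fun a => by split_ifs <;> ring
    rw [Finset.sum_congr rfl fun a _ => this a, Finset.sum_add_distrib, hsum, ← Finset.sum_mul,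
      Finset.sum_ite_mem, Finset.univ_inter]
  have hmgf0 : 0 ≤ 1 + P * (b - 1) := by
    rw [← hmgf]
    exact Finset.sum_nonneg fun a _ => mul_nonneg (hp a) (by split_ifs <;> positivity)
  clear_value P
  calc ∑ s : Fin N → α, (∏ i, p (s i)) * (Real.exp (-(Real.log b * (N * (b ^ 2 * P)))) *
        Real.exp (Real.log b * (N * ∑ a ∈ A, empFreq s a)))
      = Real.exp (-(Real.log b * (N * (b ^ 2 * P)))) * (1 + P * (b - 1)) ^ N := by
        simp only [hexp]
        rw [← hmgf, ← sum_prod_eq_pow (fun a => p a * if a ∈ A then b else 1), Finset.mul_sum]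
        refine Finset.sum_congr rfl fun s _ => ?_
        rw [Finset.prod_mul_distrib]
        ring
    _ ≤ Real.exp (-(Real.log b * (N * (b ^ 2 * P)))) * Real.exp (N * (P * (b - 1))) := by
        rw [Real.exp_nat_mul]
        gcongr
        rw [add_comm]
        exact Real.add_one_le_exp _
    _ ≤ _ := by
        rw [← Real.exp_add, Real.exp_le_exp]
        have h1 : b ^ 2 * (1 - b⁻¹) ≤ b ^ 2 * Real.log b :=
          mul_le_mul_of_nonneg_left (Real.one_sub_inv_le_log_of_pos hb) (by positivity)
        have h2 : b ^ 2 * (1 - b⁻¹) = b ^ 2 - b := by field_simp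
        have h3 := mul_le_mul_of_nonneg_left h1 (mul_nonneg hN'.le hP0)
        rw [h2] at h3
        linarith

/-- Relative entropy between two pmfs on a finite type, given as a plain finite sum. -/
def relEntropy (q p : α → ℝ) : ℝ := ∑ a, q a * Real.log (q a / p a)

theorem sum_prod_empFreq_le (hN : 0 < N) :
    ∑ s : Fin N → α, ∏ i, empFreq s (s i) ≤ ((N : ℝ) + 1) ^ Fintype.card α := by
  classical
  let c : (Fin N → α) → α → Fin (N + 1) := fun s a =>
    ⟨(Finset.univ.filter fun i => s i = a).card,
      Nat.lt_succ_of_le ((Finset.card_le_univ _).trans (by simp))⟩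
  have hc : ∀ s a, empFreq s a = ((c s a : ℕ) : ℝ) / N := fun s a => by
    simp only [empFreq, c]
  rw [← Finset.sum_fiberwise (Finset.univ : Finset (Fin N → α)) c]
  calc ∑ t, ∑ s with c s = t, ∏ i, empFreq s (s i) ≤ ∑ _t : α → Fin (N + 1), (1 : ℝ) := by
        refine Finset.sum_le_sum fun t _ => ?_
        rcases (Finset.univ.filter fun s => c s = t).eq_empty_or_nonempty with h | ⟨s₀, hs₀⟩
        · rw [h]; simp
        · have hs₀ : c s₀ = t := (Finset.mem_filter.1 hs₀).2
          have h1 : ∑ s with c s = t, ∏ i, empFreq s (s i) =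
              ∑ s with c s = t, ∏ i, empFreq s₀ (s i) := by
            refine Finset.sum_congr rfl fun s hs => Finset.prod_congr rfl fun i _ => ?_
            rw [hc, hc, (Finset.mem_filter.1 hs).2, hs₀]
          rw [h1]
          refine (Finset.sum_le_sum_of_subset_of_nonneg (Finset.filter_subset _ _) fun s _ _ =>
            Finset.prod_nonneg fun i _ => empFreq_nonneg _ _).trans ?_
          rw [sum_prod_eq_pow, sum_empFreq hN, one_pow]
    _ = _ := by simp

/-- The method of types bound for the relative entropy of the empirical distribution. -/
theorem iidProb_relEntropy_le (hp : ∀ a, 0 ≤ p a) (hN : 0 < N) (t : ℝ) :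
    iidProb p N (fun s => (∀ i, 0 < p (s i)) ∧ t < relEntropy (empFreq s) p) ≤
      ((N : ℝ) + 1) ^ Fintype.card α * Real.exp (-(N * t)) := by
  have hN' : (0 : ℝ) < N := by positivity
  rw [iidProb]
  refine le_trans ?_ (mul_le_mul_of_nonneg_right (sum_prod_empFreq_le hN) (Real.exp_nonneg _))
  rw [Finset.sum_mul]
  refine Finset.sum_le_sum fun s _ => ?_
  split_ifs with h
  · obtain ⟨hs, ht⟩ := h
    have h1 : Real.exp (N * relEntropy (empFreq s) p) * ∏ i, p (s i) = ∏ i, empFreq s (s i) := by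
      rw [relEntropy, sum_empFreq_mul hN s fun a => Real.log (empFreq s a / p a), Real.exp_sum,
        ← Finset.prod_mul_distrib]
      refine Finset.prod_congr rfl fun i _ => ?_
      rw [Real.exp_log (div_pos (empFreq_pos hN s i) (hs i)), div_mul_cancel₀ _ (hs i).ne']
    rw [← h1, mul_right_comm, ← Real.exp_add]
    refine le_mul_of_one_le_left (Finset.prod_nonneg fun i _ => hp _) (Real.one_le_exp ?_)
    have := mul_le_mul_of_nonneg_left ht.le hN'.le
    linarith
  · exact mul_nonneg (Finset.prod_nonneg fun i _ => empFreq_nonneg _ _) (Real.exp_nonneg _)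

end Sampling

/-! ### Conditional mutual information and the conditionally independent coupling -/

section CondMutInfo

variable {α β γ : Type*} {p q : α × β × γ → ℝ}

/-- The marginal of the first and third coordinates. -/
def margXZ [Fintype β] (p : α × β × γ → ℝ) (x : α) (z : γ) : ℝ := ∑ y, p (x, y, z)

/-- The marginal of the second and third coordinates. -/
def margYZ [Fintype α] (p : α × β × γ → ℝ) (y : β) (z : γ) : ℝ := ∑ x, p (x, y, z)

/-- The marginal of the third coordinate. -/
def margZ [Fintype α] [Fintype β] (p : α × β × γ → ℝ) (z : γ) : ℝ := ∑ x, ∑ y, p (x, y, z)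

/-- The conditionally independent pmf `P(x,z) P(y,z) / P(z)` with the same `XZ` and `YZ`
marginals as `p`. -/
def condIndep [Fintype α] [Fintype β] (p : α × β × γ → ℝ) (w : α × β × γ) : ℝ :=
  margXZ p w.1 w.2.2 * margYZ p w.2.1 w.2.2 / margZ p w.2.2

theorem sum_margXZ [Fintype α] [Fintype β] (p : α × β × γ → ℝ) (z : γ) : ∑ x, margXZ p x z = margZ p z := rfl

theorem sum_margYZ [Fintype α] [Fintype β] (p : α × β × γ → ℝ) (z : γ) : ∑ y, margYZ p y z = margZ p z :=
  Finset.sum_comm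

theorem margXZ_nonneg [Fintype β] (hp : ∀ w, 0 ≤ p w) (x : α) (z : γ) : 0 ≤ margXZ p x z :=
  Finset.sum_nonneg fun _ _ => hp _

theorem margYZ_nonneg [Fintype α] (hp : ∀ w, 0 ≤ p w) (y : β) (z : γ) : 0 ≤ margYZ p y z :=
  Finset.sum_nonneg fun _ _ => hp _

theorem margZ_nonneg [Fintype α] [Fintype β] (hp : ∀ w, 0 ≤ p w) (z : γ) : 0 ≤ margZ p z :=
  Finset.sum_nonneg fun _ _ => Finset.sum_nonneg fun _ _ => hp _

theorem le_margXZ [Fintype β] (hp : ∀ w, 0 ≤ p w) (x : α) (y : β) (z : γ) : p (x, y, z) ≤ margXZ p x z :=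
  Finset.single_le_sum (f := fun y => p (x, y, z)) (fun _ _ => hp _) (Finset.mem_univ y)

theorem le_margYZ [Fintype α] (hp : ∀ w, 0 ≤ p w) (x : α) (y : β) (z : γ) : p (x, y, z) ≤ margYZ p y z :=
  Finset.single_le_sum (f := fun x => p (x, y, z)) (fun _ _ => hp _) (Finset.mem_univ x)

variable [Fintype α] [Fintype β]

theorem margXZ_le_margZ (hp : ∀ w, 0 ≤ p w) (x : α) (z : γ) : margXZ p x z ≤ margZ p z :=
  Finset.single_le_sum (f := fun x => margXZ p x z) (fun _ _ => margXZ_nonneg hp _ _)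
    (Finset.mem_univ x)

theorem margYZ_le_margZ (hp : ∀ w, 0 ≤ p w) (y : β) (z : γ) : margYZ p y z ≤ margZ p z := by
  rw [← sum_margYZ]
  exact Finset.single_le_sum (f := fun y => margYZ p y z) (fun _ _ => margYZ_nonneg hp _ _)
    (Finset.mem_univ y)

theorem le_margZ (hp : ∀ w, 0 ≤ p w) (x : α) (y : β) (z : γ) : p (x, y, z) ≤ margZ p z :=
  (le_margXZ hp x y z).trans (margXZ_le_margZ hp x z)

theorem condIndep_nonneg (hp : ∀ w, 0 ≤ p w) (w : α × β × γ) : 0 ≤ condIndep p w :=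
  div_nonneg (mul_nonneg (margXZ_nonneg hp _ _) (margYZ_nonneg hp _ _)) (margZ_nonneg hp _)

theorem condIndep_pos (hp : ∀ w, 0 ≤ p w) {w : α × β × γ} (hw : 0 < p w) : 0 < condIndep p w :=
  div_pos (mul_pos (hw.trans_le (le_margXZ hp _ _ _)) (hw.trans_le (le_margYZ hp _ _ _)))
    (hw.trans_le (le_margZ hp _ _ _))

theorem eq_zero_of_condIndep_eq_zero (hp : ∀ w, 0 ≤ p w) {w : α × β × γ}
    (hw : condIndep p w = 0) : p w = 0 := by
  by_contra h
  exact (condIndep_pos hp (lt_of_le_of_ne (hp w) (Ne.symm h))).ne' hw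

theorem klTerm_condIndep_nonneg (hp : ∀ w, 0 ≤ p w) (w : α × β × γ) :
    0 ≤ klTerm (p w) (condIndep p w) :=
  klTerm_nonneg (hp w) (condIndep_nonneg hp w) (eq_zero_of_condIndep_eq_zero hp)

/-- Multiplicative closeness of `q` to `p` at an outcome and at its marginals. -/
structure IsApproxAt (p q : α × β × γ → ℝ) (w : α × β × γ) : Prop where
  joint : 9025 / 10000 * p w ≤ q w
  xz : margXZ q w.1 w.2.2 ≤ 11025 / 10000 * margXZ p w.1 w.2.2
  yz : margYZ q w.2.1 w.2.2 ≤ 11025 / 10000 * margYZ p w.2.1 w.2.2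
  z : 9025 / 10000 * margZ p w.2.2 ≤ margZ q w.2.2

theorem condIndep_le_of_isApproxAt (hp : ∀ w, 0 ≤ p w) (hq : ∀ w, 0 ≤ q w) {w : α × β × γ}
    (h : IsApproxAt p q w) (hw : 0 < p w) :
    condIndep q w ≤ 1347 / 1000 * condIndep p w := by
  obtain ⟨x, y, z⟩ := w
  have hPz := hw.trans_le (le_margZ hp x y z)
  have h1 := mul_le_mul h.xz h.yz (margYZ_nonneg hq _ _)
    (mul_nonneg (by norm_num) (margXZ_nonneg hp _ _))
  have h2 := h.z
  simp only [condIndep] at h1 h2 ⊢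
  have hX := margXZ_nonneg hp x z
  have hY := margYZ_nonneg hp y z
  have hm : 0 ≤ margXZ p x z * margYZ p y z := mul_nonneg hX hY
  calc _ ≤ (11025 / 10000 * margXZ p x z * (11025 / 10000 * margYZ p y z)) /
        (9025 / 10000 * margZ p z) := by gcongr
    _ = (11025 / 10000 * (11025 / 10000) / (9025 / 10000)) *
        (margXZ p x z * margYZ p y z / margZ p z) := by
        field_simp
    _ ≤ _ := by
        refine mul_le_mul_of_nonneg_right (by norm_num) (div_nonneg hm hPz.le)

variable [Fintype γ]

theorem sum_triple (f : α × β × γ → ℝ) : ∑ w, f w = ∑ z, ∑ x, ∑ y, f (x, y, z) := by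
  simp only [Fintype.sum_prod_type]
  rw [Finset.sum_comm (s := (Finset.univ : Finset γ))]
  exact Finset.sum_congr rfl fun x _ => Finset.sum_comm

theorem sum_margZ (p : α × β × γ → ℝ) : ∑ z, margZ p z = ∑ w, p w :=
  (sum_triple p).symm

theorem margZ_le_sum (hp : ∀ w, 0 ≤ p w) (z : γ) : margZ p z ≤ ∑ w, p w := by
  rw [← sum_margZ]
  exact Finset.single_le_sum (f := fun z => margZ p z) (fun _ _ => margZ_nonneg hp _)
    (Finset.mem_univ z)

theorem sum_condIndep (p : α × β × γ → ℝ) : ∑ w, condIndep p w = ∑ w, p w := by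
  rw [← sum_margZ p, sum_triple]
  refine Finset.sum_congr rfl fun z _ => ?_
  simp only [condIndep, ← Finset.sum_div]
  rw [← Finset.sum_mul_sum, sum_margYZ, sum_margXZ, mul_self_div_self]

theorem condMutInfo_eq_sum_mul_log (p : α × β × γ → ℝ) :
    condMutInfo p = ∑ w, p w * Real.log (p w / condIndep p w) := by
  simp only [Fintype.sum_prod_type, condMutInfo, condIndep, div_div_eq_mul_div]
  rfl

theorem condMutInfo_eq_sum_klTerm (p : α × β × γ → ℝ) :
    condMutInfo p = ∑ w, klTerm (p w) (condIndep p w) := by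
  simp only [klTerm, Finset.sum_add_distrib, Finset.sum_sub_distrib, sum_condIndep,
    condMutInfo_eq_sum_mul_log, sub_add_cancel]

theorem eq_condIndep_of_condMutInfo_eq_zero (hp : ∀ w, 0 ≤ p w) (h : condMutInfo p = 0)
    (w : α × β × γ) : p w = condIndep p w := by
  rw [condMutInfo_eq_sum_klTerm,
    Finset.sum_eq_zero_iff_of_nonneg fun w _ => klTerm_condIndep_nonneg hp w] at h
  exact eq_of_klTerm_eq_zero (hp w) (condIndep_nonneg hp w) (eq_zero_of_condIndep_eq_zero hp)
    (h w (Finset.mem_univ w))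

theorem mul_div_le_of_nonneg {a b : ℝ} (hb : 0 ≤ b) : a * (b / a) ≤ b := by
  rcases eq_or_ne a 0 with rfl | h
  · simpa using hb
  · rw [mul_div_cancel₀ _ h]

/-- Conditional mutual information is at most the relative entropy to any conditionally
independent pmf. -/
theorem condMutInfo_le_relEntropy (hp : ∀ w, 0 ≤ p w) (hpsum : ∑ w, p w = 1)
    (hpI : condMutInfo p = 0) (hq : ∀ w, 0 ≤ q w) (hqsum : ∑ w, q w = 1)
    (hpq : ∀ w, p w = 0 → q w = 0) : condMutInfo q ≤ relEntropy q p := by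
  have hpt : ∀ w : α × β × γ, q w * Real.log (q w / condIndep q w) + 2 * q w -
      q w * (margYZ p w.2.1 w.2.2 / margYZ q w.2.1 w.2.2) -
      q w * (margXZ p w.1 w.2.2 * (margZ q w.2.2 / margZ p w.2.2) / margXZ q w.1 w.2.2) ≤
      q w * Real.log (q w / p w) := by
    rintro ⟨x, y, z⟩
    rcases (hq (x, y, z)).eq_or_lt with h | hqw
    · simp [← h]
    have hpw : 0 < p (x, y, z) := lt_of_le_of_ne (hp _) fun h => hqw.ne' (hpq _ h.symm)
    have hPyz := hpw.trans_le (le_margYZ hp x y z)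
    have hPxz := hpw.trans_le (le_margXZ hp x y z)
    have hPz := hpw.trans_le (le_margZ hp x y z)
    have hQyz := hqw.trans_le (le_margYZ hq x y z)
    have hQxz := hqw.trans_le (le_margXZ hq x y z)
    have hQz := hqw.trans_le (le_margZ hq x y z)
    have h1 := Real.one_sub_inv_le_log_of_pos (div_pos hQyz hPyz)
    have h2 := Real.one_sub_inv_le_log_of_pos
      (div_pos hQxz (mul_pos hPxz (div_pos hQz hPz)))
    rw [inv_div] at h1 h2
    have h3 : Real.log (q (x, y, z) / p (x, y, z)) =
        Real.log (q (x, y, z) / condIndep q (x, y, z)) +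
        Real.log (margYZ q y z / margYZ p y z) +
        Real.log (margXZ q x z / (margXZ p x z * (margZ q z / margZ p z))) := by
      rw [← Real.log_mul (div_pos hqw (condIndep_pos hq hqw)).ne' (div_pos hQyz hPyz).ne',
        ← Real.log_mul (mul_pos (div_pos hqw (condIndep_pos hq hqw)) (div_pos hQyz hPyz)).ne'
          (div_pos hQxz (mul_pos hPxz (div_pos hQz hPz))).ne',
        eq_condIndep_of_condMutInfo_eq_zero hp hpI (x, y, z)]
      congr 1
      simp only [condIndep]
      field_simp
    rw [h3]
    have h4 := mul_le_mul_of_nonneg_left (add_le_add h1 h2) hqw.le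
    simp only
    linarith
  have hsum := Finset.sum_le_sum fun w (_ : w ∈ Finset.univ) => hpt w
  simp only [Finset.sum_sub_distrib, Finset.sum_add_distrib, ← Finset.mul_sum, hqsum,
    ← condMutInfo_eq_sum_mul_log] at hsum
  have hY : ∑ w : α × β × γ, q w * (margYZ p w.2.1 w.2.2 / margYZ q w.2.1 w.2.2) ≤ 1 := by
    rw [← hpsum, ← sum_margZ p, sum_triple]
    refine Finset.sum_le_sum fun z _ => ?_
    rw [Finset.sum_comm, ← sum_margYZ p]
    refine Finset.sum_le_sum fun y _ => ?_
    dsimp only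
    rw [← Finset.sum_mul]
    exact mul_div_le_of_nonneg (margYZ_nonneg hp y z)
  have hX : ∑ w : α × β × γ,
      q w * (margXZ p w.1 w.2.2 * (margZ q w.2.2 / margZ p w.2.2) / margXZ q w.1 w.2.2) ≤ 1 := by
    rw [← hqsum, ← sum_margZ q, sum_triple]
    refine Finset.sum_le_sum fun z _ => ?_
    calc ∑ x, ∑ y, q (x, y, z) * (margXZ p x z * (margZ q z / margZ p z) / margXZ q x z)
        ≤ ∑ x, margXZ p x z * (margZ q z / margZ p z) := by
          refine Finset.sum_le_sum fun x _ => ?_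
          rw [← Finset.sum_mul]
          exact mul_div_le_of_nonneg (mul_nonneg (margXZ_nonneg hp x z)
            (div_nonneg (margZ_nonneg hq z) (margZ_nonneg hp z)))
      _ = margZ p z * (margZ q z / margZ p z) := by rw [← Finset.sum_mul, sum_margXZ]
      _ ≤ margZ q z := mul_div_le_of_nonneg (margZ_nonneg hq z)
  rw [relEntropy]
  linarith

/-- The unnormalized squared Hellinger distance. -/
def hellingerSq {ι : Type*} [Fintype ι] (p q : ι → ℝ) : ℝ := ∑ a, (√(p a) - √(q a)) ^ 2

theorem hellingerSq_le_relEntropy {ι : Type*} [Fintype ι] {p q : ι → ℝ} (hp : ∀ w, 0 ≤ p w)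
    (hq : ∀ w, 0 ≤ q w) (hsum : ∑ w, q w = ∑ w, p w) (hpq : ∀ w, p w = 0 → q w = 0) :
    hellingerSq q p ≤ relEntropy q p := by
  have h : relEntropy q p = ∑ w, klTerm (q w) (p w) := by
    simp only [klTerm, Finset.sum_add_distrib, Finset.sum_sub_distrib, relEntropy, hsum,
      sub_add_cancel]
  rw [h]
  exact Finset.sum_le_sum fun w _ => sq_sqrt_sub_sqrt_le_klTerm (hq w) (hp w) (hpq w)

theorem hellingerSq_condIndep_le_condMutInfo (hp : ∀ w, 0 ≤ p w) :
    hellingerSq p (condIndep p) ≤ condMutInfo p := by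
  rw [condMutInfo_eq_sum_klTerm]
  exact Finset.sum_le_sum fun w _ => sq_sqrt_sub_sqrt_le_klTerm (hp w) (condIndep_nonneg hp w)
    (eq_zero_of_condIndep_eq_zero hp)

theorem sq_sub_div_mul_le {a b c a' b' c' : ℝ} (hb : c = 0 → b = 0) (ha' : c' = 0 → a' = 0) :
    (a * b / c - a' * b' / c') ^ 2 ≤ 2 * (a - a') ^ 2 * (b / c) ^ 2 +
      4 * (a' / c') ^ 2 * ((c - c') ^ 2 * (b / c) ^ 2 + (b - b') ^ 2) := by
  have h1 : b / c * c = b := by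
    by_cases h : c = 0
    · simp [h, hb h]
    · field_simp
  have h2 : a' / c' * c' = a' := by
    by_cases h : c' = 0
    · simp [h, ha' h]
    · field_simp
  have h3 : a * b / c - a' * b' / c' = (a - a') * (b / c) +
      a' / c' * ((c' - c) * (b / c) + (b - b')) := by
    calc a * b / c - a' * b' / c'
        = (a - a' / c' * c') * (b / c) + a' / c' * (c' * (b / c) - b') := by ring
      _ = (a - a' / c' * c') * (b / c) + a' / c' * ((c' - c) * (b / c) + (b / c * c - b')) := by
        ring
      _ = _ := by rw [h1, h2]
  rw [h3]
  have h4 : ∀ u v : ℝ, (u + v) ^ 2 ≤ 2 * u ^ 2 + 2 * v ^ 2 := fun u v => by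
    nlinarith [sq_nonneg (u - v)]
  have h5 := h4 ((a - a') * (b / c)) (a' / c' * ((c' - c) * (b / c) + (b - b')))
  have h6 := mul_le_mul_of_nonneg_left (h4 ((c' - c) * (b / c)) (b - b')) (sq_nonneg (a' / c'))
  simp only [mul_pow] at h5 h6
  rw [← neg_sub c' c, neg_sq]
  linarith

theorem hellingerSq_condIndep_le (hp : ∀ w, 0 ≤ p w) (hq : ∀ w, 0 ≤ q w) :
    hellingerSq (condIndep p) (condIndep q) ≤ 10 * hellingerSq p q := by
  rw [hellingerSq, hellingerSq, sum_triple, sum_triple, Finset.mul_sum]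
  refine Finset.sum_le_sum fun z _ => ?_
  set H := ∑ x, ∑ y, (√(p (x, y, z)) - √(q (x, y, z))) ^ 2 with hH
  have hX : ∑ x, (√(margXZ p x z) - √(margXZ q x z)) ^ 2 ≤ H :=
    Finset.sum_le_sum fun x _ => sq_sqrt_sum_sub_sqrt_sum_le (fun _ => hp _) fun _ => hq _
  have hY : ∑ y, (√(margYZ p y z) - √(margYZ q y z)) ^ 2 ≤ H := by
    rw [hH, Finset.sum_comm]
    exact Finset.sum_le_sum fun y _ => sq_sqrt_sum_sub_sqrt_sum_le (fun _ => hp _) fun _ => hq _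
  have hZ : (√(margZ p z) - √(margZ q z)) ^ 2 ≤ H :=
    (sq_sqrt_sum_sub_sqrt_sum_le (fun x => margXZ_nonneg hp x z)
      fun x => margXZ_nonneg hq x z).trans hX
  have hpt : ∀ x y, (√(condIndep p (x, y, z)) - √(condIndep q (x, y, z))) ^ 2 ≤
      2 * (√(margXZ p x z) - √(margXZ q x z)) ^ 2 * (margYZ p y z / margZ p z) +
      4 * (margXZ q x z / margZ q z) *
        ((√(margZ p z) - √(margZ q z)) ^ 2 * (margYZ p y z / margZ p z) +
          (√(margYZ p y z) - √(margYZ q y z)) ^ 2) := fun x y => by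
    have hs : ∀ a b : ℝ, 0 ≤ a → 0 ≤ b → a / b = (√a / √b) ^ 2 := fun a b ha hb => by
      rw [div_pow, Real.sq_sqrt ha, Real.sq_sqrt hb]
    rw [hs _ _ (margYZ_nonneg hp y z) (margZ_nonneg hp z),
      hs _ _ (margXZ_nonneg hq x z) (margZ_nonneg hq z), condIndep, condIndep,
      Real.sqrt_div' _ (margZ_nonneg hp z), Real.sqrt_div' _ (margZ_nonneg hq z),
      Real.sqrt_mul (margXZ_nonneg hp x z), Real.sqrt_mul (margXZ_nonneg hq x z)]
    refine sq_sub_div_mul_le (fun h => ?_) fun h => ?_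
    · rw [Real.sqrt_eq_zero'] at h ⊢
      exact (margYZ_le_margZ hp y z).trans h
    · rw [Real.sqrt_eq_zero'] at h ⊢
      exact (margXZ_le_margZ hq x z).trans h
  have ht : ∑ y, margYZ p y z / margZ p z ≤ 1 := by
    rw [← Finset.sum_div, sum_margYZ]
    exact div_self_le_one _
  have hu : ∑ x, margXZ q x z / margZ q z ≤ 1 := by
    rw [← Finset.sum_div, sum_margXZ]
    exact div_self_le_one _
  have ht0 : 0 ≤ ∑ y, margYZ p y z / margZ p z :=
    Finset.sum_nonneg fun y _ => div_nonneg (margYZ_nonneg hp y z) (margZ_nonneg hp z)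
  have hu0 : 0 ≤ ∑ x, margXZ q x z / margZ q z :=
    Finset.sum_nonneg fun x _ => div_nonneg (margXZ_nonneg hq x z) (margZ_nonneg hq z)
  refine (Finset.sum_le_sum fun x _ => Finset.sum_le_sum fun y _ => hpt x y).trans ?_
  simp only [Finset.sum_add_distrib, ← Finset.mul_sum, ← Finset.sum_mul]
  have hX0 : 0 ≤ ∑ x, (√(margXZ p x z) - √(margXZ q x z)) ^ 2 :=
    Finset.sum_nonneg fun _ _ => sq_nonneg _
  have hY0 : 0 ≤ ∑ y, (√(margYZ p y z) - √(margYZ q y z)) ^ 2 :=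
    Finset.sum_nonneg fun _ _ => sq_nonneg _
  have hH0 : 0 ≤ H := hX0.trans hX
  have e1 := mul_le_mul hX ht ht0 hH0
  have e2 := mul_le_mul hZ ht ht0 hH0
  have e3 := mul_le_mul hu (add_le_add e2 hY) (by positivity) zero_le_one
  linarith

theorem mul_log_inv_le {a t : ℝ} (ha : 0 < a) (ht : 0 < t) (hat : a ≤ t) (ht1 : t ≤ 1) :
    a * Real.log a⁻¹ ≤ t * (1 + Real.log t⁻¹) := by
  have h := Real.log_le_sub_one_of_pos (div_pos ht ha)
  rw [Real.log_div ht.ne' ha.ne'] at h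
  have h1 := mul_le_mul_of_nonneg_left h ha.le
  have h2 : a * (t / a - 1) = t - a := by field_simp
  have h3 := mul_le_mul_of_nonneg_right hat (Real.log_nonneg ((one_le_inv₀ ht).2 ht1))
  rw [Real.log_inv] at h3 ⊢
  rw [Real.log_inv]
  linarith

theorem klTerm_condIndep_le (hp : ∀ w, 0 ≤ p w) (hpsum : ∑ w, p w = 1) (hq : ∀ w, 0 ≤ q w)
    {t : ℝ} (ht : 0 < t) (ht1 : t ≤ 1) {w : α × β × γ} (h : t ≤ p w → IsApproxAt p q w) :
    klTerm (p w) (condIndep p w) ≤ 7 * (√(p w) - √(condIndep p w)) ^ 2 +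
      5 * klTerm (q w) (condIndep q w) + t * (1 + Real.log t⁻¹) := by
  have h1 : 0 ≤ 7 * (√(p w) - √(condIndep p w)) ^ 2 := by positivity
  have h2 := klTerm_condIndep_nonneg hq w
  have h3 : 0 ≤ t * (1 + Real.log t⁻¹) :=
    mul_nonneg ht.le (by linarith [Real.log_nonneg ((one_le_inv₀ ht).2 ht1)])
  by_cases hA : p w ≤ 9 * condIndep p w
  · linarith [klTerm_le_of_le (hp w) hA]
  push Not at hA
  have hc := condIndep_nonneg hp w
  have hw : 0 < p w := by linarith
  have hc' := condIndep_pos hp hw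
  have h4 : klTerm (p w) (condIndep p w) ≤ p w * Real.log (p w / condIndep p w) :=
    klTerm_le_mul_log (by linarith)
  by_cases hB : t ≤ p w
  · have ha := h hB
    have hqw : 0 < q w := by linarith [ha.joint]
    have := mul_log_le_klTerm_of_approx hw hc' hA (condIndep_pos hq hqw) ha.joint
      (condIndep_le_of_isApproxAt hp hq ha hw)
    linarith
  push Not at hB
  have h5 : p w / condIndep p w ≤ (p w)⁻¹ := by
    obtain ⟨x, y, z⟩ := w
    have hX := le_margXZ hp x y z
    have hY := le_margYZ hp x y z
    have hZ : margZ p z ≤ 1 := hpsum ▸ margZ_le_sum hp z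
    have hZ0 := hw.trans_le (le_margZ hp x y z)
    rw [div_le_iff₀ hc', ← div_eq_inv_mul, le_div_iff₀ hw, condIndep, le_div_iff₀ hZ0]
    have := mul_le_mul hX hY hw.le (margXZ_nonneg hp x z)
    nlinarith [mul_pos hw hw]
  have h6 := mul_le_mul_of_nonneg_left (Real.log_le_log (div_pos hw hc') h5) hw.le
  have h7 := mul_log_inv_le hw ht hB.le ht1
  linarith

/-- If `q` is close to `p` in squared Hellinger distance, and multiplicatively close to it at
every outcome of probability at least `t`, then the conditional mutual information of `q`
controls that of `p`. -/
theorem condMutInfo_le_of_isApproxAt (hp : ∀ w, 0 ≤ p w) (hpsum : ∑ w, p w = 1)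
    (hq : ∀ w, 0 ≤ q w) {t : ℝ} (ht : 0 < t) (ht1 : t ≤ 1)
    (h : ∀ w, t ≤ p w → IsApproxAt p q w) :
    condMutInfo p ≤ 26 * condMutInfo q + 231 * hellingerSq q p +
      Fintype.card (α × β × γ) * (t * (1 + Real.log t⁻¹)) := by
  have h1 := Finset.sum_le_sum fun w (_ : w ∈ Finset.univ) =>
    klTerm_condIndep_le hp hpsum hq ht ht1 (h w)
  simp only [Finset.sum_add_distrib, ← Finset.mul_sum, ← condMutInfo_eq_sum_klTerm,
    Finset.sum_const, nsmul_eq_mul, Finset.card_univ] at h1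
  have h2 : hellingerSq p (condIndep p) ≤ 3 * hellingerSq q p +
      3 * hellingerSq q (condIndep q) + 3 * hellingerSq (condIndep q) (condIndep p) := by
    simp only [hellingerSq, Finset.mul_sum, ← Finset.sum_add_distrib]
    refine Finset.sum_le_sum fun w _ => ?_
    nlinarith [sq_nonneg ((√(p w) - √(q w)) - (√(q w) - √(condIndep q w))),
      sq_nonneg ((√(q w) - √(condIndep q w)) - (√(condIndep q w) - √(condIndep p w))),
      sq_nonneg ((√(p w) - √(q w)) - (√(condIndep q w) - √(condIndep p w)))]
  have h3 := hellingerSq_condIndep_le hq hp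
  have h4 := hellingerSq_condIndep_le_condMutInfo hq
  rw [hellingerSq] at h2
  linarith

end CondMutInfo

/-! ### Concentration of the empirical distribution -/

section Concentration

theorem iidProb_mono {α : Type*} [Fintype α] {p : α → ℝ} {N : ℕ} (hp : ∀ a, 0 ≤ p a)
    {E F : (Fin N → α) → Prop} (h : ∀ s, E s → F s) : iidProb p N E ≤ iidProb p N F := by
  refine Finset.sum_le_sum fun s _ => ?_
  have h0 : 0 ≤ ∏ i, p (s i) := Finset.prod_nonneg fun i _ => hp _
  by_cases hE : E s
  · simp [hE, h s hE]
  · rw [if_neg hE]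
    split_ifs <;> simp [h0]

variable {α ι : Type*} [Fintype α] [Fintype ι] {p : α → ℝ} {N : ℕ}

theorem iidProb_upper_tail_le (hp : ∀ a, 0 ≤ p a) (hsum : ∑ a, p a = 1) (hN : 0 < N)
    {f : ι → α} (hf : Function.Injective f) {t : ℝ} (ht : t ≤ ∑ j, p (f j)) :
    iidProb p N (fun s => ¬ ∑ j, empFreq s (f j) ≤ 11025 / 10000 * ∑ j, p (f j)) ≤
      Real.exp (-(1 / 400 * (N * t))) := by
  have h := iidProb_chernoff hp hsum hN (Finset.univ.map ⟨f, hf⟩)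
    (show (0 : ℝ) < 105 / 100 by norm_num)
  simp only [Finset.sum_map, Function.Embedding.coeFn_mk] at h
  refine (iidProb_mono hp fun s hs => ?_).trans (h.trans (Real.exp_le_exp.2 ?_))
  · refine mul_le_mul_of_nonneg_left ?_ (Real.log_nonneg (by norm_num))
    push Not at hs
    norm_num at hs ⊢
    linarith
  · have := mul_le_mul_of_nonneg_left ht (Nat.cast_nonneg (α := ℝ) N)
    norm_num
    linarith

theorem iidProb_lower_tail_le (hp : ∀ a, 0 ≤ p a) (hsum : ∑ a, p a = 1) (hN : 0 < N)
    {f : ι → α} (hf : Function.Injective f) {t : ℝ} (ht : t ≤ ∑ j, p (f j)) :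
    iidProb p N (fun s => ¬ 9025 / 10000 * ∑ j, p (f j) ≤ ∑ j, empFreq s (f j)) ≤
      Real.exp (-(1 / 400 * (N * t))) := by
  have h := iidProb_chernoff hp hsum hN (Finset.univ.map ⟨f, hf⟩)
    (show (0 : ℝ) < 95 / 100 by norm_num)
  simp only [Finset.sum_map, Function.Embedding.coeFn_mk] at h
  refine (iidProb_mono hp fun s hs => ?_).trans (h.trans (Real.exp_le_exp.2 ?_))
  · refine mul_le_mul_of_nonpos_left ?_ (Real.log_nonpos (by norm_num) (by norm_num))
    push Not at hs
    norm_num at hs ⊢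
    linarith
  · have := mul_le_mul_of_nonneg_left ht (Nat.cast_nonneg (α := ℝ) N)
    norm_num
    linarith

theorem iidProb_not_isApproxAt_le {α β γ : Type*} [Fintype α] [Fintype β] [Fintype γ]
    {p : α × β × γ → ℝ} (hp : ∀ w, 0 ≤ p w) (hsum : ∑ w, p w = 1) (hN : 0 < N) {t : ℝ}
    {w : α × β × γ} (ht : t ≤ p w) :
    iidProb p N (fun s => ¬ IsApproxAt p (empFreq s) w) ≤
      4 * Real.exp (-(1 / 400 * (N * t))) := by
  obtain ⟨x, y, z⟩ := w
  have h1 := iidProb_lower_tail_le hp hsum hN (f := fun _ : Unit => (x, y, z))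
    (fun _ _ _ => rfl) (t := t) (by simpa using ht)
  have h2 := iidProb_upper_tail_le hp hsum hN (f := fun y' : β => (x, y', z))
    (fun _ _ h => by simpa using h) (ht.trans (le_margXZ hp x y z))
  have h3 := iidProb_upper_tail_le hp hsum hN (f := fun x' : α => (x', y, z))
    (fun _ _ h => by simpa using h) (ht.trans (le_margYZ hp x y z))
  have h4 := iidProb_lower_tail_le hp hsum hN (f := fun v : α × β => (v.1, v.2, z))
    (fun _ _ h => by simpa [Prod.ext_iff] using h) (t := t)
    (by rw [Fintype.sum_prod_type]; exact ht.trans (le_margZ hp x y z))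
  simp only [Fintype.sum_prod_type, Finset.univ_unique, Finset.sum_singleton] at h1 h4
  have h5 := (iidProb_or_le hp _ _).trans (add_le_add h1 h2)
  have h6 := (iidProb_or_le hp _ _).trans (add_le_add h3 h4)
  refine (iidProb_mono hp fun s hs => ?_).trans
    (((iidProb_or_le hp _ _).trans (add_le_add h5 h6)).trans (by linarith))
  by_contra hcon
  push Not at hcon
  obtain ⟨⟨ha, hb⟩, hc, hd⟩ := hcon
  exact hs ⟨ha, hb, hc, hd⟩

end Concentration

/-! ### Sample size estimates -/

section SampleSize

variable {k ε δ : ℝ}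

theorem le_cube_of_sampleSize (hk : 2 ≤ k) (hε0 : 0 < ε) (hε1 : ε ≤ 1) (hδ0 : 0 < δ)
    (hδ1 : δ ≤ 1) : 800 * (k ^ 3 / ε) ≤ (7.2 * 10 ^ 5 * (k / (ε * δ))) ^ 3 := by
  have hm : k / ε ≤ k / (ε * δ) := by
    refine div_le_div_of_nonneg_left (by linarith) (by positivity) ?_
    nlinarith
  have h1 : k ^ 3 / ε ≤ (k / ε) ^ 3 := by
    rw [div_pow]
    refine div_le_div_of_nonneg_left (by positivity) (by positivity) ?_
    exact pow_le_of_le_one hε0.le hε1 (by norm_num)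
  have h2 : (k / ε) ^ 3 ≤ (k / (ε * δ)) ^ 3 := by gcongr
  have h3 : 0 ≤ (k / (ε * δ)) ^ 3 := by positivity
  rw [mul_pow]
  norm_num
  linarith

theorem one_le_log_of_three_le {a : ℝ} (ha : 3 ≤ a) : 1 ≤ Real.log a := by
  rw [Real.le_log_iff_exp_le (by linarith)]
  linarith [Real.exp_one_lt_d9]

theorem three_le_sampleSize (hk : 2 ≤ k) (hε0 : 0 < ε) (hε1 : ε ≤ 1) (hδ0 : 0 < δ)
    (hδ1 : δ ≤ 1) : 3 ≤ 7.2 * 10 ^ 5 * (k / (ε * δ)) := by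
  have : k ≤ k / (ε * δ) := le_div_self (by linarith) (by positivity) (by nlinarith)
  norm_num
  linarith

theorem cube_mul_threshold_le (hk : 2 ≤ k) (hε0 : 0 < ε) (hε1 : ε ≤ 1) (hδ0 : 0 < δ)
    (hδ1 : δ ≤ 1) {L t : ℝ} (hL : L = Real.log (7.2 * 10 ^ 5 * (k / (ε * δ))))
    (ht : t = ε / (40 * k ^ 3 * L)) : k ^ 3 * (t * (1 + Real.log t⁻¹)) ≤ ε / 10 := by
  have hM := three_le_sampleSize hk hε0 hε1 hδ0 hδ1
  have hL1 : 1 ≤ L := hL ▸ one_le_log_of_three_le hM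
  have hcube := le_cube_of_sampleSize hk hε0 hε1 hδ0 hδ1
  have hlog : Real.log (40 * (k ^ 3 / ε)) ≤ 3 * L := by
    have : Real.log (40 * (k ^ 3 / ε)) ≤ Real.log ((7.2 * 10 ^ 5 * (k / (ε * δ))) ^ 3) := by
      refine Real.log_le_log (by positivity) (le_trans ?_ hcube)
      gcongr
      norm_num
    rwa [Real.log_pow, ← hL] at this
  have hinv : t⁻¹ = 40 * (k ^ 3 / ε) * L := by rw [ht, inv_div]; ring
  have hbound : 1 + Real.log t⁻¹ ≤ 4 * L := by
    rw [hinv, Real.log_mul (by positivity) (by positivity)]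
    linarith [Real.log_le_sub_one_of_pos (show 0 < L by linarith)]
  have ht0 : 0 < t := by rw [ht]; positivity
  calc k ^ 3 * (t * (1 + Real.log t⁻¹)) ≤ k ^ 3 * (t * (4 * L)) := by gcongr
    _ = ε / 10 := by
      rw [ht]
      have : 0 < k := by linarith
      field_simp
      norm_num

theorem four_mul_cube_mul_exp_le (hk : 2 ≤ k) (hε0 : 0 < ε) (hδ0 : 0 < δ)
    (hδ1 : δ ≤ 1) {L t n : ℝ} (hL : 1 ≤ L) (ht : t = ε / (40 * k ^ 3 * L))
    (hn : 6.48 * 10 ^ 6 * (k ^ 3 * L * Real.log (12 * k ^ 2 / δ)) / ε ≤ n) :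
    k ^ 3 * (4 * Real.exp (-(1 / 400 * (n * t)))) ≤ δ / 2 := by
  have hk0 : 0 < k := by linarith
  have h12 : 3 ≤ 12 * k ^ 2 / δ := by
    rw [le_div_iff₀ hδ0]; nlinarith
  have hL2 := one_le_log_of_three_le h12
  set L₂ := Real.log (12 * k ^ 2 / δ) with hL₂
  have ht0 : 0 < t := by rw [ht]; positivity
  have h1 : 2 * L₂ ≤ 1 / 400 * (n * t) := by
    have := mul_le_mul_of_nonneg_right hn ht0.le
    have h2 : 6.48 * 10 ^ 6 * (k ^ 3 * L * L₂) / ε * t = 162000 * L₂ := by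
      rw [ht]; field_simp; norm_num
    rw [h2] at this
    linarith
  have h2 : Real.exp (-(1 / 400 * (n * t))) ≤ (δ / (12 * k ^ 2)) ^ 2 := by
    have h3 : Real.exp (-(2 * L₂)) = (δ / (12 * k ^ 2)) ^ 2 := by
      rw [← inv_div, inv_pow, Real.exp_neg, two_mul, Real.exp_add, hL₂,
        Real.exp_log (by positivity), ← sq]
    rw [← h3]
    exact Real.exp_le_exp.2 (by linarith)
  calc k ^ 3 * (4 * Real.exp (-(1 / 400 * (n * t))))
      ≤ k ^ 3 * (4 * (δ / (12 * k ^ 2)) ^ 2) := by gcongr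
    _ = δ * δ / (36 * k) := by field_simp; norm_num
    _ ≤ δ / 2 := by
      rw [div_le_div_iff₀ (by positivity) (by norm_num)]
      nlinarith

theorem pow_mul_exp_le {d N : ℕ} (hd : (d : ℝ) = k ^ 3) (hk : 2 ≤ k) (hε0 : 0 < ε) (hε1 : ε ≤ 1)
    (hδ0 : 0 < δ) (hδ1 : δ ≤ 1) {L : ℝ} (hL : L = Real.log (7.2 * 10 ^ 5 * (k / (ε * δ))))
    (hn : 6.48 * 10 ^ 6 * (k ^ 3 * L * Real.log (12 * k ^ 2 / δ)) / ε ≤ N) :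
    ((N : ℝ) + 1) ^ d * Real.exp (-(N * (ε / 400))) ≤ δ / 2 := by
  have hk0 : 0 < k := by linarith
  have hM := three_le_sampleSize hk hε0 hε1 hδ0 hδ1
  have hL1 : 1 ≤ L := hL ▸ one_le_log_of_three_le hM
  have h12 : 3 ≤ 12 * k ^ 2 / δ := by
    rw [le_div_iff₀ hδ0]; nlinarith
  have hL2 := one_le_log_of_three_le h12
  have hdelta : Real.log (2 / δ) ≤ Real.log (12 * k ^ 2 / δ) := by
    refine Real.log_le_log (by positivity) ?_
    gcongr
    nlinarith
  set L₂ := Real.log (12 * k ^ 2 / δ)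
  have hK : 1 ≤ k ^ 3 := one_le_pow₀ (by linarith)
  have hcube := le_cube_of_sampleSize hk hε0 hε1 hδ0 hδ1
  have hlog : Real.log (800 * (k ^ 3 / ε)) ≤ 3 * L := by
    have := Real.log_le_log (by positivity) hcube
    rwa [Real.log_pow, ← hL] at this
  have hN1 : (0 : ℝ) < N + 1 := by positivity
  have ha : 0 < 800 * (k ^ 3 / ε) := by positivity
  have htan := Real.log_le_sub_one_of_pos (div_pos hN1 ha)
  rw [Real.log_div hN1.ne' ha.ne'] at htan
  have h1 : k ^ 3 * Real.log (N + 1) ≤ ε * (N + 1) / 800 + k ^ 3 * (3 * L) - k ^ 3 := by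
    have h2 : k ^ 3 * ((N + 1) / (800 * (k ^ 3 / ε))) = ε * (N + 1) / 800 := by field_simp
    have h3 := mul_le_mul_of_nonneg_left
      (show Real.log (N + 1) ≤ (N + 1) / (800 * (k ^ 3 / ε)) + 3 * L - 1 by linarith)
      (zero_le_one.trans hK)
    linarith
  have h4 : 6.48 * 10 ^ 6 * (k ^ 3 * L * L₂) ≤ N * ε := by
    rwa [div_le_iff₀ hε0] at hn
  have h5 : k ^ 3 * L ≤ k ^ 3 * L * L₂ := le_mul_of_one_le_right (by positivity) hL2
  have h6 : L₂ ≤ k ^ 3 * L * L₂ :=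
    le_mul_of_one_le_left (by linarith) (one_le_mul_of_one_le_of_one_le hK hL1)
  have h7 : k ^ 3 * Real.log (N + 1) + -(N * (ε / 400)) ≤ -Real.log (2 / δ) := by
    norm_num at h4
    linarith
  rw [← Real.exp_log (show (0 : ℝ) < (N + 1) ^ d by positivity), ← Real.exp_add, Real.log_pow, hd]
  refine (Real.exp_le_exp.2 h7).trans ?_
  rw [← Real.log_inv, inv_div, Real.exp_log (by positivity)]

end SampleSize

/-- Conditional MI tester with explicit constants (Theorem of Appendix B of the paper). -/
theorem cmi_tester_explicit (S : Type) [Fintype S] (hS : 2 ≤ Fintype.card S)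
    (p : S × S × S → ℝ) (hp : ∀ w, 0 ≤ p w) (hsum : (∑ w, p w) = 1)
    (ε δ : ℝ) (hε0 : 0 < ε) (hε1 : ε ≤ 1) (hδ0 : 0 < δ) (hδ1 : δ ≤ 1)
    (N : ℕ)
    (hN : 6.48 * 10 ^ 6 *
        ((Fintype.card S : ℝ) ^ 3 *
          (Real.log ((Fintype.card S : ℝ) / (ε * δ)) + Real.log (7.2 * 10 ^ 5)) *
          Real.log (12 * (Fintype.card S : ℝ) ^ 2 / δ)) / ε ≤ (N : ℝ)) :
    1 - δ ≤ iidProb p N (fun s =>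
      (condMutInfo p = 0 → condMutInfo (empFreq s) ≤ ε / 400) ∧
      (ε ≤ condMutInfo p → condMutInfo p / 400 ≤ condMutInfo (empFreq s))) := by
  have hk : (2 : ℝ) ≤ Fintype.card S := by exact_mod_cast hS
  have hcard : (Fintype.card (S × S × S) : ℝ) = (Fintype.card S : ℝ) ^ 3 := by
    simp only [Fintype.card_prod]
    push_cast
    ring
  set k : ℝ := (Fintype.card S : ℝ)
  have hk0 : 0 < k := by linarith
  have hM := three_le_sampleSize hk hε0 hε1 hδ0 hδ1
  rw [← Real.log_mul (by positivity) (by norm_num), mul_comm (k / (ε * δ))] at hN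
  obtain ⟨L, hL⟩ : ∃ L, L = Real.log (7.2 * 10 ^ 5 * (k / (ε * δ))) := ⟨_, rfl⟩
  rw [← hL] at hN
  have hL1 : 1 ≤ L := hL ▸ one_le_log_of_three_le hM
  have hN0 : 0 < N := by
    have h12 : 3 ≤ 12 * k ^ 2 / δ := by
      rw [le_div_iff₀ hδ0]; nlinarith
    have hL2 := one_le_log_of_three_le h12
    have : (0 : ℝ) < N := lt_of_lt_of_le (by positivity) hN
    exact_mod_cast this
  obtain ⟨t, ht⟩ : ∃ t, t = ε / (40 * k ^ 3 * L) := ⟨_, rfl⟩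
  have ht0 : 0 < t := by rw [ht]; positivity
  have ht1 : t ≤ 1 := by
    have hK : 1 ≤ k ^ 3 := one_le_pow₀ (by linarith)
    rw [ht, div_le_one (by positivity)]
    nlinarith [one_le_mul_of_one_le_of_one_le hK hL1]
  have hKL := (iidProb_relEntropy_le hp hN0 (ε / 400)).trans
    (pow_mul_exp_le hcard hk hε0 hε1 hδ0 hδ1 hL hN)
  have hApprox : iidProb p N (fun s => ∃ w, t ≤ p w ∧ ¬ IsApproxAt p (empFreq s) w) ≤ δ / 2 := by
    refine (iidProb_exists_le hp _).trans (le_trans ?_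
      (four_mul_cube_mul_exp_le hk hε0 hδ0 hδ1 hL1 ht hN))
    rw [← hcard, ← nsmul_eq_mul, ← Finset.card_univ]
    refine Finset.sum_le_card_nsmul _ _ _ fun w _ => ?_
    by_cases hw : t ≤ p w
    · simpa only [hw, true_and] using iidProb_not_isApproxAt_le hp hsum hN0 hw
    · simp only [hw, false_and, iidProb, if_false, Finset.sum_const_zero]
      positivity
  have hbad := (iidProb_or_le hp _ _).trans (add_le_add hKL hApprox)
  refine le_trans (by linarith) (one_sub_le_iidProb hp hsum fun s hs hB => ?_)
  push Not at hB
  obtain ⟨hB1, hB2⟩ := hB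
  have hD := hB1 hs
  have hq := empFreq_nonneg s
  have hqsum := sum_empFreq hN0 s
  have hpq : ∀ w, p w = 0 → empFreq s w = 0 := fun w hw => empFreq_eq_zero hs hw
  refine ⟨fun h0 => (condMutInfo_le_relEntropy hp hsum h0 hq hqsum hpq).trans hD, fun hI => ?_⟩
  have h1 := condMutInfo_le_of_isApproxAt hp hsum hq ht0 ht1 hB2
  have h2 := (hellingerSq_le_relEntropy hp hq (hqsum.trans hsum.symm) hpq).trans hD
  have h3 := cube_mul_threshold_le hk hε0 hε1 hδ0 hδ1 hL ht
  rw [hcard] at h1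
  linarith
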